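/- arXiv:0811.2469 — 6 statements merged into one kernel-verified Lean document; each statement's English description precedes it below -/
import Mathlib

section
/- The function b₃*(v) = −(−6·tan v + 2v²·tan v + 5v) / (6v(v·tan v − v² + 1)) tends to 1/6 as v → 0 (v ≠ 0); i.e., the singularity of b₃* at v = 0 is removable and the limiting value is the classical weight b₃ = 1/6. -/
open Filter Topology

/-- b₃*(v) = −(−6 tan v + 2v² tan v + 5v)/(6v(v tan v − v² + 1)) tends to 1/6
as v → 0 with v ≠ 0. -/
theorem rk3_b3_limit :
    Tendsto (fun v : ℝ =>
        -((-6 * Real.tan v + 2 * v^2 * Real.tan v + 5 * v) /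
          (6 * v * (v * Real.tan v - v^2 + 1))))
      (𝓝[≠] (0 : ℝ)) (𝓝 (1/6)) := by
  have hslope : Tendsto (fun v : ℝ => Real.tan v / v) (𝓝[≠] 0) (𝓝 1) := by
    have h : HasDerivAt Real.tan 1 0 := by
      simpa using Real.hasDerivAt_tan (x := 0) (by simp)
    refine h.tendsto_slope.congr fun v => ?_
    simp [slope_def_field]
  have hv : Tendsto (fun v : ℝ => v) (𝓝[≠] 0) (𝓝 0) := tendsto_nhdsWithin_of_tendsto_nhds tendsto_id
  have htan : Tendsto Real.tan (𝓝[≠] 0) (𝓝 0) := by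
    have h : ContinuousAt Real.tan 0 := Real.continuousAt_tan.2 (by simp)
    simpa using tendsto_nhdsWithin_of_tendsto_nhds h.tendsto
  have hnum := ((hslope.const_mul (-6)).add (((hv.pow 2).const_mul 2).mul hslope)).add_const 5
  have hden := (((hv.mul htan).sub (hv.pow 2)).add_const 1).const_mul 6
  have hlim := (hnum.div hden (by norm_num)).neg
  norm_num only at hlim
  refine hlim.congr' ?_
  filter_upwards [self_mem_nhdsWithin] with v hv0
  replace hv0 : v ≠ 0 := hv0
  rw [Pi.div_apply, ← mul_div_mul_left _ _ hv0]
  congr 2 <;> field_simp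
end

section
/- With b₃*(v) = −(−6·tan v + 2v²·tan v + 5v) / (6v(v·tan v − v² + 1)), the limit as v → 0 (v ≠ 0) of (b₃*(v) − 1/6)/v⁴ equals −1/30. -/
open Filter Topology

/-- The fifth-order Taylor polynomials of `cos` and `sin` approximate them to order six. -/
lemma abs_cos_sin_sub_taylor_five_le {v : ℝ} (hv : |v| ≤ 1) :
    |Real.cos v - (1 - v ^ 2 / 2 + v ^ 4 / 24)| ≤ |v| ^ 6 ∧
      |Real.sin v - (v - v ^ 3 / 6 + v ^ 5 / 120)| ≤ |v| ^ 6 := by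
  have hnorm : ‖(v : ℂ) * Complex.I‖ = |v| := by simp
  have hbound := Complex.exp_bound (x := (v : ℂ) * Complex.I) (by rwa [hnorm])
    (n := 6) (by norm_num)
  rw [hnorm] at hbound
  have hsplit : Complex.exp ((v : ℂ) * Complex.I) -
        ∑ m ∈ Finset.range 6, ((v : ℂ) * Complex.I) ^ m / (m.factorial : ℂ) =
      ((Real.cos v - (1 - v ^ 2 / 2 + v ^ 4 / 24) : ℝ) : ℂ) +
        ((Real.sin v - (v - v ^ 3 / 6 + v ^ 5 / 120) : ℝ) : ℂ) * Complex.I := by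
    have h3 : Complex.I ^ 3 = -Complex.I := Complex.I_pow_three
    have h4 : Complex.I ^ 4 = 1 := Complex.I_pow_four
    have h5 : Complex.I ^ 5 = Complex.I := by rw [pow_succ, h4, one_mul]
    rw [Complex.exp_mul_I]
    simp only [Finset.sum_range_succ, Finset.sum_range_zero, mul_pow, h3, h4, h5, Complex.I_sq,
      Nat.factorial]
    push_cast
    ring
  rw [hsplit] at hbound
  have hle : |v| ^ 6 * (((Nat.succ 6 : ℕ) : ℝ) * (((Nat.factorial 6 : ℕ) : ℝ) * (6 : ℕ))⁻¹) ≤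
      |v| ^ 6 := by
    refine mul_le_of_le_one_right (by positivity) ?_
    norm_num [Nat.factorial]
  have hre := (Complex.abs_re_le_norm _).trans (hbound.trans hle)
  have him := (Complex.abs_im_le_norm _).trans (hbound.trans hle)
  simp only [Complex.add_re, Complex.ofReal_re, Complex.re_ofReal_mul, Complex.I_re, mul_zero,
    add_zero] at hre
  simp only [Complex.add_im, Complex.ofReal_im, Complex.im_ofReal_mul, Complex.I_im, mul_one,
    zero_add] at him
  exact ⟨hre, him⟩

/-- A function bounded by `|v| ^ 6` near `0` is negligible against `v ^ 5`. -/

lemma tendsto_div_pow_five_of_abs_le_pow_six {R : ℝ → ℝ}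
    (hR : ∀ v : ℝ, |v| ≤ 1 → |R v| ≤ |v| ^ 6) :
    Tendsto (fun v : ℝ => R v / v ^ 5) (𝓝[≠] (0 : ℝ)) (𝓝 0) := by
  have habs : Tendsto (fun v : ℝ => |v|) (𝓝[≠] (0 : ℝ)) (𝓝 0) := by
    simpa using (continuous_abs.tendsto (0 : ℝ)).mono_left nhdsWithin_le_nhds
  refine squeeze_zero_norm' ?_ habs
  filter_upwards [self_mem_nhdsWithin, habs.eventually_le_const one_pos] with v hv hv1
  have hpos : 0 < |v| := abs_pos.mpr hv
  rw [Real.norm_eq_abs, abs_div, abs_pow, div_le_iff₀ (by positivity)]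
  exact (hR v hv1).trans_eq (by ring)

/-- With b₃*(v) as in the first optimized method, (b₃*(v) − 1/6)/v⁴ → −1/30
as v → 0 with v ≠ 0. -/
theorem rk3_b3_expansion_v4 :
    Tendsto (fun v : ℝ =>
        ((-((-6 * Real.tan v + 2 * v^2 * Real.tan v + 5 * v) /
            (6 * v * (v * Real.tan v - v^2 + 1)))) - 1/6) / v^4)
      (𝓝[≠] (0 : ℝ)) (𝓝 (-1/30)) := by
  have hc := tendsto_div_pow_five_of_abs_le_pow_six
    (fun v hv => (abs_cos_sin_sub_taylor_five_le hv).1)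
  have hs := tendsto_div_pow_five_of_abs_le_pow_six
    (fun v hv => (abs_cos_sin_sub_taylor_five_le hv).2)
  have hid : Tendsto (fun v : ℝ => v) (𝓝[≠] (0 : ℝ)) (𝓝 0) :=
    tendsto_id.mono_left nhdsWithin_le_nhds
  have hcos : Tendsto Real.cos (𝓝[≠] (0 : ℝ)) (𝓝 1) := by
    simpa using (Real.continuous_cos.tendsto 0).mono_left nhdsWithin_le_nhds
  have htan : Tendsto Real.tan (𝓝[≠] (0 : ℝ)) (𝓝 0) := by
    simpa using ((Real.continuousAt_tan (x := 0)).mpr (by simp)).tendsto.mono_left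
      nhdsWithin_le_nhds
  have hden : Tendsto (fun v : ℝ => v * Real.tan v - v ^ 2 + 1) (𝓝[≠] (0 : ℝ)) (𝓝 1) := by
    simpa using ((hid.mul htan).sub (hid.pow 2)).add_const 1
  have hnum := (((hid.pow 2).div_const 60).const_add (-1 / 5)).add
    ((((hid.pow 2).const_mul 3).const_sub 6).mul hs) |>.sub
    (((hid.const_mul 6).sub (hid.pow 3)).mul hc)
  have hlim := hnum.div ((hcos.const_mul 6).mul hden) (by norm_num)
  norm_num at hlim ⊢
  refine hlim.congr' ?_
  filter_upwards [self_mem_nhdsWithin, hcos.eventually_ne one_ne_zero,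
    hden.eventually_ne one_ne_zero] with v hv hcv hdv
  have hv : v ≠ 0 := hv
  have htc : Real.sin v = Real.tan v * Real.cos v := (Real.tan_mul_cos hcv).symm
  simp only [Pi.div_apply, htc]
  generalize Real.tan v = t at *
  generalize Real.cos v = c at *
  generalize hd : v * t - v ^ 2 + 1 = d at *
  field_simp
  rw [← hd]
  ring
end

section
/- With b₃*(v) = −(−6·tan v + 2v²·tan v + 5v) / (6v(v·tan v − v² + 1)), the limit as v → 0 (v ≠ 0) of (b₃*(v) − 1/6 + v⁴/30)/v⁶ equals −4/315. -/
open Filter Topology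

theorem Real.tendsto_sin_taylor_seven_remainder :
    Tendsto (fun v : ℝ =>
        (Real.sin v - (v - v ^ 3 / 6 + v ^ 5 / 120 - v ^ 7 / 5040)) / v ^ 7)
      (𝓝[≠] (0 : ℝ)) (𝓝 0) := by
  have h := (taylor_isLittleO_univ (x₀ := (0 : ℝ)) (n := 7)
    Real.contDiff_sin).tendsto_div_nhds_zero
  refine (h.mono_left nhdsWithin_le_nhds).congr fun v => ?_
  simp only [taylorWithinEval_succ, taylor_within_zero_eval, iteratedDerivWithin_univ,
    iteratedDeriv_succ, iteratedDeriv_zero, Real.deriv_sin, Real.deriv_cos', deriv.fun_neg',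
    Real.sin_zero, Real.cos_zero, smul_eq_mul, sub_zero]
  norm_num [Nat.factorial]
  ring

theorem Real.tendsto_cos_taylor_six_remainder :
    Tendsto (fun v : ℝ =>
        (Real.cos v - (1 - v ^ 2 / 2 + v ^ 4 / 24 - v ^ 6 / 720)) / v ^ 6)
      (𝓝[≠] (0 : ℝ)) (𝓝 0) := by
  have h := (taylor_isLittleO_univ (x₀ := (0 : ℝ)) (n := 6)
    Real.contDiff_cos).tendsto_div_nhds_zero
  refine (h.mono_left nhdsWithin_le_nhds).congr fun v => ?_
  simp only [taylorWithinEval_succ, taylor_within_zero_eval, iteratedDerivWithin_univ,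
    iteratedDeriv_succ, iteratedDeriv_zero, Real.deriv_sin, Real.deriv_cos', deriv.fun_neg',
    Real.sin_zero, Real.cos_zero, smul_eq_mul, sub_zero]
  norm_num [Nat.factorial]
  ring

/-- With b₃*(v) as in the first optimized method, (b₃*(v) − 1/6 + v⁴/30)/v⁶ → −4/315
as v → 0 with v ≠ 0. -/
theorem rk3_b3_expansion_v6 :
    Tendsto (fun v : ℝ =>
        ((-((-6 * Real.tan v + 2 * v^2 * Real.tan v + 5 * v) /
            (6 * v * (v * Real.tan v - v^2 + 1)))) - 1/6 + v^4/30) / v^6)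
      (𝓝[≠] (0 : ℝ)) (𝓝 (-4/315)) := by
  have hv : Tendsto (fun v : ℝ => v) (𝓝[≠] 0) (𝓝 0) :=
    tendsto_nhdsWithin_of_tendsto_nhds tendsto_id
  have hs := Real.tendsto_sin_taylor_seven_remainder
  have hc := Real.tendsto_cos_taylor_six_remainder
  have hden : Tendsto (fun v : ℝ => v * Real.sin v - v ^ 2 * Real.cos v + Real.cos v)
      (𝓝[≠] 0) (𝓝 1) := by
    refine tendsto_nhdsWithin_of_tendsto_nhds (Continuous.tendsto' (by fun_prop) _ _ ?_)
    simp
  have hcos : ∀ᶠ v : ℝ in 𝓝[≠] 0, Real.cos v ≠ 0 :=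
    (tendsto_nhdsWithin_of_tendsto_nhds (Real.continuous_cos.tendsto' 0 1 (by simp))).eventually_ne
      one_ne_zero
  let F : ℝ × ℝ × ℝ → ℝ := fun p =>
    -8 / 105 - 6 * p.2.2 + 6 * p.2.1 +
      p.1 ^ 2 * (187 / 2520 + p.2.2 - 3 * p.2.1) +
      p.1 ^ 4 * (-1 / 144 + p.2.2 / 5) +
      p.1 ^ 6 * (1 / 4200 - p.2.2 / 5 + p.2.1 / 5)
  have hnum := ((show Continuous F by fun_prop).tendsto' (0, 0, 0) (-8 / 105) (by simp [F])).comp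
    (hv.prodMk_nhds (hs.prodMk_nhds hc))
  have hlim := hnum.div (hden.const_mul 6) (by norm_num)
  rw [show (-8 / 105 : ℝ) / (6 * 1) = -4 / 315 by norm_num] at hlim
  refine hlim.congr' ?_
  filter_upwards [self_mem_nhdsWithin, hcos, hden.eventually_ne one_ne_zero] with v hv0 hcv hdv
  have hv0 : v ≠ 0 := hv0
  have hdt : v * Real.tan v - v ^ 2 + 1 =
      (v * Real.sin v - v ^ 2 * Real.cos v + Real.cos v) / Real.cos v := by
    rw [Real.tan_eq_sin_div_cos]
    field_simp
  simp only [Pi.div_apply, Function.comp_apply, F]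
  rw [hdt, Real.tan_eq_sin_div_cos]
  generalize hD : v * Real.sin v - v ^ 2 * Real.cos v + Real.cos v = D at hdv ⊢
  field_simp
  rw [← hD]
  ring
end

section
/- With b₃*(v) = −(−6·tan v + 2v²·tan v + 5v) / (6v(v·tan v − v² + 1)), the limit as v → 0 (v ≠ 0) of (b₃*(v) − 1/6 + v⁴/30 + 4v⁶/315)/v⁸ equals 17/2835. -/
open Filter Topology

/-- The degree nine Taylor expansion of the sine at the origin. -/
lemma tendsto_sin_sub_taylor_div :
    Tendsto (fun v : ℝ => (Real.sin v -
        (v - v ^ 3 / 6 + v ^ 5 / 120 - v ^ 7 / 5040 + v ^ 9 / 362880)) / v ^ 9)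
      (𝓝 0) (𝓝 0) := by
  have h := Real.taylor_tendsto (n := 9) convex_univ (Set.mem_univ (0 : ℝ))
    Real.contDiff_sin.contDiffOn
  rw [nhdsWithin_univ] at h
  refine h.congr fun v => ?_
  simp [taylor_within_apply, iteratedDerivWithin_univ, Nat.factorial]
  ring

/-- The degree eight Taylor expansion of the cosine at the origin. -/
lemma tendsto_cos_sub_taylor_div :
    Tendsto (fun v : ℝ => (Real.cos v -
        (1 - v ^ 2 / 2 + v ^ 4 / 24 - v ^ 6 / 720 + v ^ 8 / 40320)) / v ^ 8)
      (𝓝 0) (𝓝 0) := by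
  have h := Real.taylor_tendsto (n := 8) convex_univ (Set.mem_univ (0 : ℝ))
    Real.contDiff_cos.contDiffOn
  rw [nhdsWithin_univ] at h
  refine h.congr fun v => ?_
  simp [taylor_within_apply, iteratedDerivWithin_univ, Nat.factorial]
  ring

/-- With b₃*(v) as in the first optimized method,
(b₃*(v) − 1/6 + v⁴/30 + 4v⁶/315)/v⁸ → 17/2835 as v → 0 with v ≠ 0. -/
theorem rk3_b3_expansion_v8 :
    Tendsto (fun v : ℝ =>
        ((-((-6 * Real.tan v + 2 * v^2 * Real.tan v + 5 * v) /
            (6 * v * (v * Real.tan v - v^2 + 1)))) - 1/6 + v^4/30 + 4*v^6/315) / v^8)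
      (𝓝[≠] (0 : ℝ)) (𝓝 (17/2835)) := by
  have tendsto_of_continuous {f : ℝ → ℝ} (hf : Continuous f) : Tendsto f (𝓝 0) (𝓝 (f 0)) :=
    hf.tendsto 0
  have hden : Continuous fun v : ℝ => v * Real.sin v + (1 - v ^ 2) * Real.cos v := by fun_prop
  have hlim := (((tendsto_of_continuous (f := fun v => 34 / 945 + 187 / 8640 * v ^ 2
      - 1453 / 604800 * v ^ 4 + 1 / 11340 * v ^ 6 - 1 / 595350 * v ^ 8) (by fun_prop)).add
    ((tendsto_of_continuous (f := fun v => 6 - 2 * v ^ 2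
      + v ^ 2 * (-1 + v ^ 4 / 5 + 8 * v ^ 6 / 105)) (by fun_prop)).mul
      tendsto_sin_sub_taylor_div)).add
    ((tendsto_of_continuous (f := fun v => -5
      + (1 - v ^ 2) * (-1 + v ^ 4 / 5 + 8 * v ^ 6 / 105)) (by fun_prop)).mul
      tendsto_cos_sub_taylor_div)).div
    ((tendsto_of_continuous hden).const_mul 6) (by simp)
  have hval : (17 / 2835 : ℝ) = 34 / 945 / 6 := by norm_num
  rw [hval]
  refine Tendsto.congr' ?_ (by simpa using hlim.mono_left nhdsWithin_le_nhds)
  have hcos : ∀ᶠ v in 𝓝[≠] (0 : ℝ), Real.cos v ≠ 0 :=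
    nhdsWithin_le_nhds (Real.continuous_cos.continuousAt.eventually_ne (by simp))
  have hden_ne : ∀ᶠ v in 𝓝[≠] (0 : ℝ), v * Real.sin v + (1 - v ^ 2) * Real.cos v ≠ 0 :=
    nhdsWithin_le_nhds (hden.continuousAt.eventually_ne (by simp))
  filter_upwards [hcos, hden_ne, self_mem_nhdsWithin] with v hc hd hv
  have hv : v ≠ 0 := hv
  have htan_den : v * Real.tan v - v ^ 2 + 1 =
      (v * Real.sin v + (1 - v ^ 2) * Real.cos v) / Real.cos v := by
    rw [Real.tan_eq_sin_div_cos]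
    field_simp
    ring
  simp only [Pi.div_apply]
  rw [htan_den, Real.tan_eq_sin_div_cos]
  field_simp
  ring
end

section
/- For the classical weights b₂ = 2/3, b₃ = 1/6, the phase-lag expression PL(v) = (1 − v²/2)·tan v − v + v³/6 satisfies lim_{v→0, v≠0} PL(v)/v⁵ = −1/30; in particular the phase lag of the classical method is O(v⁵), so the classical method has dispersive order 4, while the optimized methods have vanishing phase lag. -/
open Filter Topology

lemma tendsto_div_pow_succ_of_hasDerivAt {f f' : ℝ → ℝ} {L : ℝ} (n : ℕ)
    (hf : ∀ x, HasDerivAt f (f' x) x) (h0 : f 0 = 0)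
    (h : Tendsto (fun x => f' x / x ^ n) (𝓝[≠] 0) (𝓝 L)) :
    Tendsto (fun x => f x / x ^ (n + 1)) (𝓝[≠] 0) (𝓝 (L / (n + 1))) := by
  have hn : (n + 1 : ℝ) ≠ 0 := by positivity
  refine HasDerivAt.lhopital_zero_nhdsNE (f' := f') (g' := fun x => (n + 1 : ℝ) * x ^ n)
    (.of_forall hf) (.of_forall fun x => by simpa using hasDerivAt_pow (n + 1) x) ?_ ?_ ?_ ?_
  · filter_upwards [self_mem_nhdsWithin] with x hx
    exact mul_ne_zero hn (pow_ne_zero _ hx)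
  · simpa [h0] using (hf 0).continuousAt.tendsto.mono_left nhdsWithin_le_nhds
  · simpa using ((continuous_pow (n + 1)).tendsto (0 : ℝ)).mono_left nhdsWithin_le_nhds
  · refine (h.div_const (n + 1 : ℝ)).congr fun x => ?_
    rw [div_div, mul_comm]

lemma tendsto_cos_sub_one_div_sq :
    Tendsto (fun x : ℝ => (Real.cos x - 1) / x ^ 2) (𝓝[≠] 0) (𝓝 (-1 / 2)) := by
  have h : Tendsto (fun x : ℝ => -Real.sin x / x ^ 1) (𝓝[≠] 0) (𝓝 (-1)) := by
    simpa using tendsto_div_pow_succ_of_hasDerivAt (f := fun x => -Real.sin x) (L := -1) 0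
      (fun x => (Real.hasDerivAt_sin x).neg) (by simp)
      (by simpa using (Real.continuous_cos.tendsto 0).mono_left nhdsWithin_le_nhds)
  convert tendsto_div_pow_succ_of_hasDerivAt 1
    (fun x => (Real.hasDerivAt_cos x).sub_const 1) (by simp) h using 2
  norm_num

lemma tendsto_sin_sub_taylor_div_cube :
    Tendsto (fun x : ℝ => (Real.sin x - x) / x ^ 3) (𝓝[≠] 0) (𝓝 (-1 / 6)) := by
  convert tendsto_div_pow_succ_of_hasDerivAt 2
    (fun x => (Real.hasDerivAt_sin x).sub (hasDerivAt_id x)) (by simp)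
    tendsto_cos_sub_one_div_sq using 2
  all_goals norm_num

lemma tendsto_cos_sub_taylor_div_pow_four :
    Tendsto (fun x : ℝ => (Real.cos x - (1 - x ^ 2 / 2)) / x ^ 4) (𝓝[≠] 0) (𝓝 (1 / 24)) := by
  convert tendsto_div_pow_succ_of_hasDerivAt (f := fun x => Real.cos x - (1 - x ^ 2 / 2))
    (f' := fun x => -(Real.sin x - x)) (L := 1 / 6) 3 (fun x => ?_) (by simp) ?_ using 2
  · norm_num
  · refine ((Real.hasDerivAt_cos x).sub
      (((hasDerivAt_pow 2 x).div_const 2).const_sub 1)).congr_deriv ?_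
    norm_num
    ring
  · convert tendsto_sin_sub_taylor_div_cube.neg using 2 <;> ring

lemma tendsto_sin_sub_taylor_div_pow_five :
    Tendsto (fun x : ℝ => (Real.sin x - (x - x ^ 3 / 6)) / x ^ 5) (𝓝[≠] 0) (𝓝 (1 / 120)) := by
  convert tendsto_div_pow_succ_of_hasDerivAt (f := fun x => Real.sin x - (x - x ^ 3 / 6)) 4
    (fun x => ?_) (by simp) tendsto_cos_sub_taylor_div_pow_four using 2
  · norm_num
  · refine ((Real.hasDerivAt_sin x).sub
      ((hasDerivAt_id x).sub ((hasDerivAt_pow 3 x).div_const 6))).congr_deriv ?_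
    norm_num
    ring

/-- For the classical weights b₂ = 2/3, b₃ = 1/6, the phase-lag expression
PL(v) = (1 − v²/2)·tan v − v + v³/6 satisfies PL(v)/v⁵ → −1/30 as v → 0, v ≠ 0:
the classical method has dispersive order 4. -/
theorem rk3_classical_phase_lag_order :
    Tendsto (fun v : ℝ =>
        ((1 - v^2/2) * Real.tan v - v + v^3/6) / v^5)
      (𝓝[≠] (0 : ℝ)) (𝓝 (-1/30)) := by
  have hpoly (c : ℝ) : Tendsto (fun v : ℝ => 1 - v ^ 2 / c) (𝓝[≠] 0) (𝓝 1) := by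
    have : Continuous fun v : ℝ => 1 - v ^ 2 / c := by fun_prop
    simpa using (this.tendsto 0).mono_left nhdsWithin_le_nhds
  have hcos : Tendsto Real.cos (𝓝[≠] 0) (𝓝 1) := by
    simpa using (Real.continuous_cos.tendsto 0).mono_left nhdsWithin_le_nhds
  have key := (((hpoly 2).mul tendsto_sin_sub_taylor_div_pow_five).sub
    ((hpoly 6).mul tendsto_cos_sub_taylor_div_pow_four)).div hcos one_ne_zero
  rw [show (1 * (1 / 120) - 1 * (1 / 24)) / 1 = (-1 / 30 : ℝ) by norm_num] at key
  refine key.congr' ?_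
  filter_upwards [self_mem_nhdsWithin, hcos.eventually_ne one_ne_zero] with v hv hc
  have hv : v ≠ 0 := hv
  simp only [Pi.div_apply, Real.tan_eq_sin_div_cos]
  field_simp
  ring
end

section
/- Let β₂(v) and β₃(v) be the weights of the second optimized method. The residual of the first-order condition, Rem₁(v) = 1/6 + β₂(v) + β₃(v) − 1, satisfies lim_{v→0, v≠0} Rem₁(v)/v⁴ = 1/30; in particular Rem₁(v) → 0 as v → 0, so the first-order condition Σbᵢ = 1 holds in the limit. -/
open Filter Topology

lemma hasDerivAt_tan_one_add_sq {x : ℝ} (hx : Real.cos x ≠ 0) :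
    HasDerivAt Real.tan (1 + Real.tan x ^ 2) x := by
  convert Real.hasDerivAt_tan hx using 1
  rw [← Real.inv_one_add_tan_sq hx, one_div, inv_inv]

lemma eventually_cos_ne_zero_nhdsNE : ∀ᶠ x in 𝓝[≠] (0 : ℝ), Real.cos x ≠ 0 :=
  (Real.continuous_cos.continuousAt.eventually_ne (by simp)).filter_mono nhdsWithin_le_nhds

lemma tendsto_tan_nhdsNE_zero : Tendsto Real.tan (𝓝[≠] 0) (𝓝 0) := by
  have h : ContinuousAt Real.tan 0 := Real.continuousAt_tan.2 (by simp)
  simpa [ContinuousAt] using h.tendsto.mono_left nhdsWithin_le_nhds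

lemma tendsto_id_nhdsNE_zero : Tendsto (fun x : ℝ => x) (𝓝[≠] 0) (𝓝 0) :=
  tendsto_id.mono_left nhdsWithin_le_nhds

lemma tendsto_tan_div_self : Tendsto (fun x => Real.tan x / x) (𝓝[≠] 0) (𝓝 1) := by
  have h := (hasDerivAt_tan_one_add_sq (x := 0) (by simp)).tendsto_slope_zero
  simpa [div_eq_inv_mul] using h

lemma tendsto_tan_sub_self_div_cube :
    Tendsto (fun x => (Real.tan x - x) / x ^ 3) (𝓝[≠] 0) (𝓝 (1 / 3)) := by
  have hid := tendsto_id_nhdsNE_zero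
  refine HasDerivAt.lhopital_zero_nhdsNE (f' := fun x => 1 + Real.tan x ^ 2 - 1)
    (g' := fun x => 3 * x ^ 2) ?_ ?_ ?_ ?_ ?_ ?_
  · filter_upwards [eventually_cos_ne_zero_nhdsNE] with x hx
    exact (hasDerivAt_tan_one_add_sq hx).sub (hasDerivAt_id x)
  · exact Eventually.of_forall fun x => by simpa using hasDerivAt_pow 3 x
  · filter_upwards [self_mem_nhdsWithin] with x hx
    have : x ≠ 0 := hx
    positivity
  · simpa using tendsto_tan_nhdsNE_zero.sub hid
  · simpa using hid.pow 3
  · have h := (tendsto_tan_div_self.pow 2).div_const 3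
    norm_num at h ⊢
    refine h.congr fun x => ?_
    rw [div_pow, div_div, mul_comm]

lemma tendsto_tan_sub_cubic_div_pow_five :
    Tendsto (fun x => (Real.tan x - x - x ^ 3 / 3) / x ^ 5) (𝓝[≠] 0) (𝓝 (2 / 15)) := by
  have hid := tendsto_id_nhdsNE_zero
  refine HasDerivAt.lhopital_zero_nhdsNE (f' := fun x => 1 + Real.tan x ^ 2 - 1 - x ^ 2)
    (g' := fun x => 5 * x ^ 4) ?_ ?_ ?_ ?_ ?_ ?_
  · filter_upwards [eventually_cos_ne_zero_nhdsNE] with x hx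
    refine ((hasDerivAt_tan_one_add_sq hx).sub (hasDerivAt_id x)).sub ?_
    simpa using (hasDerivAt_pow 3 x).div_const 3
  · exact Eventually.of_forall fun x => by simpa using hasDerivAt_pow 5 x
  · filter_upwards [self_mem_nhdsWithin] with x hx
    have : x ≠ 0 := hx
    positivity
  · simpa using (tendsto_tan_nhdsNE_zero.sub hid).sub ((hid.pow 3).div_const 3)
  · simpa using hid.pow 5
  · have h := (tendsto_tan_sub_self_div_cube.mul (tendsto_tan_div_self.add_const 1)).div_const 5
    norm_num at h
    refine h.congr' ?_
    filter_upwards [self_mem_nhdsWithin] with x hx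
    have : x ≠ 0 := hx
    field_simp
    ring

/-- The residual Rem₁(v) = 1/6 + β₂(v) + β₃(v) − 1 of the first-order condition
satisfies Rem₁(v)/v⁴ → 1/30 as v → 0 (v ≠ 0); in particular Rem₁(v) → 0, so the
first-order condition Σbᵢ = 1 holds in the limit. -/
theorem rk3_second_method_first_order_residual :
    Tendsto (fun v : ℝ =>
        (1/6 + ((12 * v + v^3 + v^2 * Real.tan v - 12 * Real.tan v + v^3 * Real.tan v ^ 2) /
          (6 * v^2 * (-3 * v + Real.tan v + v * Real.tan v ^ 2 - v^2 * Real.tan v + v^3 + v^3 * Real.tan v ^ 2))) + ((5 * v^3 * Real.tan v ^ 2 + 7 * v^3 - 19 * v^2 * Real.tan v + 6 * v * Real.tan v ^ 2 - 6 * v + 6 * Real.tan v) /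
          (3 * v^2 * (-3 * v + Real.tan v + v * Real.tan v ^ 2 - v^2 * Real.tan v + v^3 + v^3 * Real.tan v ^ 2))) - 1) / v^4)
      (𝓝[≠] (0 : ℝ)) (𝓝 (1/30)) ∧
    Tendsto (fun v : ℝ =>
        1/6 + ((12 * v + v^3 + v^2 * Real.tan v - 12 * Real.tan v + v^3 * Real.tan v ^ 2) /
          (6 * v^2 * (-3 * v + Real.tan v + v * Real.tan v ^ 2 - v^2 * Real.tan v + v^3 + v^3 * Real.tan v ^ 2))) + ((5 * v^3 * Real.tan v ^ 2 + 7 * v^3 - 19 * v^2 * Real.tan v + 6 * v * Real.tan v ^ 2 - 6 * v + 6 * Real.tan v) /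
          (3 * v^2 * (-3 * v + Real.tan v + v * Real.tan v ^ 2 - v^2 * Real.tan v + v^3 + v^3 * Real.tan v ^ 2))) - 1)
      (𝓝[≠] (0 : ℝ)) (𝓝 0) := by
  set F : ℝ → ℝ := fun v =>
    1/6 + ((12 * v + v^3 + v^2 * Real.tan v - 12 * Real.tan v + v^3 * Real.tan v ^ 2) /
          (6 * v^2 * (-3 * v + Real.tan v + v * Real.tan v ^ 2 - v^2 * Real.tan v + v^3 + v^3 * Real.tan v ^ 2))) + ((5 * v^3 * Real.tan v ^ 2 + 7 * v^3 - 19 * v^2 * Real.tan v + 6 * v * Real.tan v ^ 2 - 6 * v + 6 * Real.tan v) /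
          (3 * v^2 * (-3 * v + Real.tan v + v * Real.tan v ^ 2 - v^2 * Real.tan v + v^3 + v^3 * Real.tan v ^ 2))) - 1 with hF
  have key : Tendsto (fun v => F v / v ^ 4) (𝓝[≠] 0) (𝓝 (1 / 30)) := by
    have hv := tendsto_id_nhdsNE_zero
    have hq := tendsto_tan_div_self
    have hs := tendsto_tan_sub_self_div_cube
    have hr := tendsto_tan_sub_cubic_div_pow_five
    have hG := ((((hr.const_mul (-18)).add ((hs.pow 2).const_mul 12)).add
      (hs.const_mul 17)).sub ((hq.pow 2).const_mul 5)).add (((hv.pow 2).mul (hs.pow 2)).const_mul 6)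
    have hE := ((((hq.const_add (-3)).add ((hv.pow 2).mul (hq.pow 2))).sub
      ((hv.pow 2).mul hq)).add (hv.pow 2)).add ((hv.pow 4).mul (hq.pow 2))
    have hlim := hG.div (hE.const_mul 6) (by norm_num)
    norm_num at hlim
    refine Tendsto.congr' ?_ (by simpa using hlim)
    filter_upwards [self_mem_nhdsWithin, hE.eventually_ne (by norm_num : _ ≠ (0 : ℝ))] with v hv0 hEv
    have hv0 : v ≠ 0 := hv0
    simp only [hF, Pi.div_apply]
    generalize Real.tan v = t at hEv ⊢
    obtain ⟨q, rfl⟩ : ∃ q, t = v * q := ⟨t / v, by field_simp⟩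
    rw [mul_div_cancel_left₀ q hv0] at hEv ⊢
    set E := -3 + q + v ^ 2 * q ^ 2 - v ^ 2 * q + v ^ 2 + v ^ 4 * q ^ 2 with hEdef
    have hD : -3 * v + v * q + v * (v * q) ^ 2 - v ^ 2 * (v * q) + v ^ 3
        + v ^ 3 * (v * q) ^ 2 = v * E := by rw [hEdef]; ring
    rw [hD]
    clear_value E
    field_simp
    rw [hEdef]
    ring
  refine ⟨key, ?_⟩
  have h := key.mul (tendsto_id_nhdsNE_zero.pow 4)
  norm_num at h
  refine h.congr' ?_
  filter_upwards [self_mem_nhdsWithin] with v hv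
  have : v ≠ 0 := hv
  field_simp
end
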